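/- Let q ≥ 2, 0 < ρ < 1, and α > 0. Let X be any finitely supported real random variable with E[X] = 0, −1 ≤ X ≤ α, and X not almost surely 0. Then R_{q,ρ}(X) ≤ R_{q,ρ}(X_α), with equality if and only if X has the same distribution as X_α. -/

import Mathlib

open Finset

/-- `N_{q,ρ}(X) = E[(1+ρX)^q]` for a finitely supported random variable given by its
probability mass function `ν : ℝ →₀ ℝ` on values. -/
noncomputable def Nfun (ν : ℝ →₀ ℝ) (q ρ : ℝ) : ℝ :=
  ∑ t ∈ ν.support, ν t * (1 + ρ * t) ^ q

/-- `R_{q,ρ}(X) = ln N_{q,ρ}(X) / ln N_{q,1}(X)`. -/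
noncomputable def Rfun (ν : ℝ →₀ ℝ) (q ρ : ℝ) : ℝ :=
  Real.log (Nfun ν q ρ) / Real.log (Nfun ν q 1)

/-- The distribution of `X_α`: value `α` with probability `1/(1+α)` and value `-1`
with probability `α/(1+α)`. -/
noncomputable def XalphaDist (α : ℝ) : ℝ →₀ ℝ :=
  Finsupp.single α (1 / (1 + α)) + Finsupp.single (-1) (α / (1 + α))

/-- `E[(1+ρX_{v-1})^q]`, as a function of the larger value `v` of `1 + X_{v-1}`. -/
noncomputable def twoPointMoment (q ρ v : ℝ) : ℝ :=
  (1 - ρ) ^ q + ((1 - ρ + ρ * v) ^ q - (1 - ρ) ^ q) / v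

lemma sub_le_sub_of_hasDerivAt_le {f g f' g' : ℝ → ℝ}
    (hf : ∀ x, HasDerivAt f (f' x) x) (hg : ∀ x, HasDerivAt g (g' x) x)
    (h : ∀ x ∈ Set.Ioo (0 : ℝ) 1, f' x ≤ g' x) : f 1 - f 0 ≤ g 1 - g 0 := by
  have hd : ∀ x, HasDerivAt (fun y => g y - f y) (g' x - f' x) x :=
    fun x => (hg x).sub (hf x)
  have hm : MonotoneOn (fun y => g y - f y) (Set.Icc (0 : ℝ) 1) := by
    refine monotoneOn_of_deriv_nonneg (convex_Icc 0 1)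
      (fun x _ => (hd x).continuousAt.continuousWithinAt)
      (fun x _ => (hd x).differentiableAt.differentiableWithinAt) fun x hx => ?_
    rw [interior_Icc] at hx
    rw [(hd x).deriv]
    linarith [h x hx]
  have := hm (Set.left_mem_Icc.2 zero_le_one) (Set.right_mem_Icc.2 zero_le_one) zero_le_one
  simp only at this
  linarith

lemma hasDerivAt_affine_rpow {q : ℝ} (hq : 1 ≤ q) (a b x : ℝ) :
    HasDerivAt (fun y => (a + b * y) ^ q) (b * q * (a + b * x) ^ (q - 1)) x := by
  have h : HasDerivAt (fun y => a + b * y) b x := by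
    simpa using ((hasDerivAt_id x).const_mul b).const_add a
  exact h.rpow_const (Or.inr hq)

lemma add_mul_rpow_le {p a c u v : ℝ} (hp : 1 ≤ p) (ha : 0 < a) (hc : 0 < c) (hu : 0 ≤ u)
    (hv : 0 < v) :
    (a + c * u) ^ p ≤
      (a + c * v) ^ p * (a / (a + c * v) + c * v / (a + c * v) * (u ^ p / v ^ p)) := by
  have hs : 0 < a + c * v := by positivity
  have hl : 0 ≤ a / (a + c * v) := by positivity
  have hr : 0 ≤ c * v / (a + c * v) := by positivity
  have hJ := (convexOn_rpow hp).2 (Set.mem_Ici.2 zero_le_one)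
    (Set.mem_Ici.2 (div_nonneg hu hv.le)) hl hr (by field_simp)
  simp only [smul_eq_mul, Real.one_rpow, mul_one] at hJ
  rw [Real.div_rpow hu hv.le] at hJ
  have he : a + c * u = (a + c * v) * (a / (a + c * v) + c * v / (a + c * v) * (u / v)) := by
    field_simp
  rw [he, Real.mul_rpow hs.le (by positivity)]
  gcongr

lemma sum_mul_add_mul_rpow_le {ι : Type*} {s : Finset ι} {w u : ι → ℝ} {p a c v : ℝ}
    (hp : 1 ≤ p) (ha : 0 < a) (hc : 0 < c) (hv : 0 < v) (hw : ∀ i ∈ s, 0 ≤ w i)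
    (hu : ∀ i ∈ s, 0 ≤ u i) (hws : ∑ i ∈ s, w i = 1) (hwu : ∑ i ∈ s, w i * u i ^ p = v ^ p) :
    ∑ i ∈ s, w i * (a + c * u i) ^ p ≤ (a + c * v) ^ p := by
  have hs : 0 < a + c * v := by positivity
  have hvp : 0 < v ^ p := Real.rpow_pos_of_pos hv p
  calc ∑ i ∈ s, w i * (a + c * u i) ^ p
      ≤ ∑ i ∈ s, w i * ((a + c * v) ^ p *
          (a / (a + c * v) + c * v / (a + c * v) * (u i ^ p / v ^ p))) :=
        Finset.sum_le_sum fun i hi =>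
          mul_le_mul_of_nonneg_left (add_mul_rpow_le hp ha hc (hu i hi) hv) (hw i hi)
    _ = (a + c * v) ^ p * (a / (a + c * v)) * ∑ i ∈ s, w i +
          (a + c * v) ^ p * (c * v / (a + c * v)) / v ^ p * ∑ i ∈ s, w i * u i ^ p := by
        rw [Finset.mul_sum, Finset.mul_sum, ← Finset.sum_add_distrib]
        exact Finset.sum_congr rfl fun i _ => by ring
    _ = (a + c * v) ^ p := by
        rw [hws, hwu]
        field_simp

/-- Among nonnegative variables `u` of mean one with a given `q`-th moment `v ^ (q - 1)`, the
two-point variable with values `0` and `v` maximizes the `q`-th moment of `1 - ρ + ρ u`. -/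
lemma sum_rpow_le_twoPointMoment {ι : Type*} {s : Finset ι} {w u : ι → ℝ} {q ρ v : ℝ}
    (hq : 2 ≤ q) (hρ0 : 0 < ρ) (hρ1 : ρ < 1) (hv : 0 < v) (hw : ∀ i ∈ s, 0 ≤ w i)
    (hu : ∀ i ∈ s, 0 ≤ u i) (hws : ∑ i ∈ s, w i = 1) (hwu : ∑ i ∈ s, w i * u i = 1)
    (hmom : ∑ i ∈ s, w i * u i ^ q = v ^ (q - 1)) :
    ∑ i ∈ s, w i * (1 - ρ + ρ * u i) ^ q ≤ twoPointMoment q ρ v := by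
  have hq1 : 1 ≤ q := by linarith
  have key := sub_le_sub_of_hasDerivAt_le
    (f := fun x => ∑ i ∈ s, w i * (1 - ρ + ρ * u i * x) ^ q)
    (f' := fun x => ∑ i ∈ s, w i * (ρ * u i * q * (1 - ρ + ρ * u i * x) ^ (q - 1)))
    (g := fun x => (1 - ρ + ρ * v * x) ^ q / v)
    (g' := fun x => ρ * v * q * (1 - ρ + ρ * v * x) ^ (q - 1) / v)
    (fun x => HasDerivAt.fun_sum fun i _ => (hasDerivAt_affine_rpow hq1 _ _ x).const_mul (w i))
    (fun x => (hasDerivAt_affine_rpow hq1 _ _ x).div_const v) ?_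
  · have h0 : ∑ i ∈ s, w i * (1 - ρ) ^ q = (1 - ρ) ^ q := by
      rw [← Finset.sum_mul, hws, one_mul]
    simp only [mul_one, mul_zero, add_zero, h0] at key
    rw [twoPointMoment, sub_div]
    linarith
  · intro x hx
    have hM := sum_mul_add_mul_rpow_le (s := s) (w := fun i => w i * u i) (u := u) (p := q - 1)
      (a := 1 - ρ) (c := ρ * x) (v := v) (by linarith) (by linarith) (mul_pos hρ0 hx.1) hv
      (fun i hi => mul_nonneg (hw i hi) (hu i hi)) hu hwu (by
        rw [← hmom]
        refine Finset.sum_congr rfl fun i hi => ?_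
        have : u i ^ q = u i * u i ^ (q - 1) := by
          conv_rhs => rw [← Real.rpow_one_add' (hu i hi) (by linarith)]
          congr 1; ring
        rw [this, mul_assoc])
    calc ∑ i ∈ s, w i * (ρ * u i * q * (1 - ρ + ρ * u i * x) ^ (q - 1))
        = ρ * q * ∑ i ∈ s, w i * u i * (1 - ρ + ρ * x * u i) ^ (q - 1) := by
          rw [Finset.mul_sum]
          refine Finset.sum_congr rfl fun i _ => ?_
          rw [mul_right_comm ρ x]; ring
      _ ≤ ρ * q * (1 - ρ + ρ * x * v) ^ (q - 1) := by gcongr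
      _ = ρ * v * q * (1 - ρ + ρ * v * x) ^ (q - 1) / v := by
          rw [mul_right_comm ρ x]; field_simp

lemma twoPointMoment_eq {q ρ v : ℝ} (hv : 0 < v) :
    twoPointMoment q ρ v = 1 / v * (1 - ρ + ρ * v) ^ q + (v - 1) / v * (1 - ρ) ^ q := by
  rw [twoPointMoment]; field_simp; ring

lemma one_lt_twoPointMoment {q ρ v : ℝ} (hq : 1 < q) (hρ0 : 0 < ρ) (hρ1 : ρ < 1) (hv : 1 < v) :
    1 < twoPointMoment q ρ v := by
  have hv0 : 0 < v := by linarith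
  have h1 := one_add_mul_self_lt_rpow_one_add (s := ρ * (v - 1)) (p := q)
    (by nlinarith) (by nlinarith) hq
  have h2 := one_add_mul_self_lt_rpow_one_add (s := -ρ) (p := q)
    (by linarith) (by linarith) hq
  rw [twoPointMoment_eq hv0]
  have e1 : 1 + ρ * (v - 1) = 1 - ρ + ρ * v := by ring
  have e2 : 1 + -ρ = 1 - ρ := by ring
  rw [e1] at h1
  rw [e2] at h2
  calc (1 : ℝ) = 1 / v * (1 + q * (ρ * (v - 1))) + (v - 1) / v * (1 + q * -ρ) := by
        field_simp; ring
    _ < _ := by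
        have : 0 < (v - 1) / v := div_pos (by linarith) hv0
        gcongr

/-- Hölder's inequality for two terms, with exponents `1 / θ` and `1 / (1 - θ)`. -/
lemma add_mul_rpow_le_rpow_mul_rpow {a c v θ : ℝ} (ha : 0 < a) (hc : 0 < c) (hv : 0 < v)
    (h0 : 0 < θ) (h1 : θ < 1) :
    a + c * v ^ θ ≤ (a + c * v) ^ θ * (a + c) ^ (1 - θ) := by
  have hs : 0 < a + c * v := by positivity
  have hr : 0 < a + c := by positivity
  have A1 := Real.geom_mean_le_arith_mean2_weighted (w₁ := θ) (w₂ := 1 - θ)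
    (p₁ := a / (a + c * v)) (p₂ := a / (a + c)) h0.le (by linarith) (by positivity)
    (by positivity) (by ring)
  have A2 := Real.geom_mean_le_arith_mean2_weighted (w₁ := θ) (w₂ := 1 - θ)
    (p₁ := c * v / (a + c * v)) (p₂ := c / (a + c)) h0.le (by linarith) (by positivity)
    (by positivity) (by ring)
  rw [Real.div_rpow (by positivity) hs.le, Real.div_rpow (by positivity) hr.le] at A1 A2
  have ea : a ^ θ * a ^ (1 - θ) = a := by
    rw [← Real.rpow_add ha]; simp
  have ec : (c * v) ^ θ * c ^ (1 - θ) = c * v ^ θ := by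
    rw [Real.mul_rpow hc.le hv.le, mul_right_comm, ← Real.rpow_add hc]; simp
  have hS : 0 < (a + c * v) ^ θ * (a + c) ^ (1 - θ) := by positivity
  rw [div_mul_div_comm, ea] at A1
  rw [div_mul_div_comm, ec] at A2
  have : (a + c * v ^ θ) / ((a + c * v) ^ θ * (a + c) ^ (1 - θ)) ≤ 1 := by
    rw [add_div]
    refine (add_le_add A1 A2).trans_eq ?_
    field_simp
    ring
  exact (div_le_one hS).1 this

/-- `y ↦ log (twoPointMoment q ρ (exp y))` lies strictly below its chords from the origin. -/
lemma twoPointMoment_rpow_lt {q ρ v θ : ℝ} (hq : 1 < q) (hρ0 : 0 < ρ) (hρ1 : ρ < 1) (hv : 1 < v)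
    (h0 : 0 < θ) (h1 : θ < 1) :
    twoPointMoment q ρ (v ^ θ) < twoPointMoment q ρ v ^ θ := by
  have hM := one_lt_twoPointMoment hq hρ0 hρ1 hv
  have hMv : twoPointMoment q ρ v =
    (1 - ρ) ^ q + ((1 - ρ + ρ * v) ^ q - (1 - ρ) ^ q) / v := rfl
  set M := twoPointMoment q ρ v with hMdef
  have hM0 : 0 < M := by linarith
  have hv0 : 0 < v := by linarith
  have hw0 : 0 < v ^ θ := by positivity
  have ha : 0 < 1 - ρ := by linarith
  have hMθ : 0 < M ^ θ := by positivity
  have young : ∀ {x y : ℝ}, 0 < x → 0 < y →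
      x ^ θ * y ^ (1 - θ) ≤ M ^ θ * (θ * (x / M) + (1 - θ) * y) := by
    intro x y hx hy
    have := Real.geom_mean_le_arith_mean2_weighted (w₁ := θ) (w₂ := 1 - θ)
      (p₁ := x / M) (p₂ := y) h0.le (by linarith) (by positivity) hy.le (by ring)
    calc x ^ θ * y ^ (1 - θ) = M ^ θ * ((x / M) ^ θ * y ^ (1 - θ)) := by
          rw [Real.div_rpow hx.le hM0.le]; field_simp
      _ ≤ _ := by gcongr
  have key := sub_le_sub_of_hasDerivAt_le
    (f := fun x => (1 - ρ + ρ * v ^ θ * x) ^ q / v ^ θ)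
    (f' := fun x => ρ * v ^ θ * q * (1 - ρ + ρ * v ^ θ * x) ^ (q - 1) / v ^ θ)
    (g := fun x => M ^ θ * θ / M / v * (1 - ρ + ρ * v * x) ^ q +
      M ^ θ * (1 - θ) * (1 - ρ + ρ * x) ^ q)
    (g' := fun x => M ^ θ * θ / M / v * (ρ * v * q * (1 - ρ + ρ * v * x) ^ (q - 1)) +
      M ^ θ * (1 - θ) * (ρ * q * (1 - ρ + ρ * x) ^ (q - 1)))
    (fun x => (hasDerivAt_affine_rpow hq.le _ _ x).div_const _)
    (fun x => ((hasDerivAt_affine_rpow hq.le _ _ x).const_mul _).add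
      ((hasDerivAt_affine_rpow hq.le _ _ x).const_mul _)) ?_
  · have hstrict : (1 : ℝ) < M ^ θ * (θ / M + (1 - θ)) := by
      have hb := rpow_one_add_lt_one_add_mul_self (s := 1 / M - 1) (p := θ)
        (by have : 0 < 1 / M := by positivity
            linarith)
        (by have : 1 / M < 1 := (div_lt_one hM0).2 hM
            exact ne_of_lt (by linarith)) h0 h1
      rw [show 1 + (1 / M - 1) = 1 / M by ring, Real.div_rpow zero_le_one hM0.le,
        Real.one_rpow, div_lt_iff₀ hMθ] at hb
      calc (1 : ℝ) < _ := hb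
        _ = _ := by ring
    have hpos : 0 < (1 - ρ) ^ q := by positivity
    have hlt := mul_lt_mul_of_pos_right hstrict hpos
    have e1 : (1 - ρ + ρ : ℝ) = 1 := by ring
    simp only [mul_one, mul_zero, add_zero, e1, Real.one_rpow] at key
    have hM1 : M ^ θ * θ / M / v * (1 - ρ + ρ * v) ^ q =
        M ^ θ * θ - M ^ θ * θ / M * (1 - ρ) ^ q + M ^ θ * θ / M / v * (1 - ρ) ^ q := by
      have : ((1 - ρ + ρ * v) ^ q - (1 - ρ) ^ q) / v = M - (1 - ρ) ^ q := by linarith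
      calc _ = M ^ θ * θ / M * (((1 - ρ + ρ * v) ^ q - (1 - ρ) ^ q) / v) +
            M ^ θ * θ / M / v * (1 - ρ) ^ q := by ring
        _ = _ := by rw [this]; field_simp
    rw [hM1] at key
    rw [twoPointMoment, sub_div]
    have e2 : M ^ θ * (θ / M + (1 - θ)) * (1 - ρ) ^ q =
        M ^ θ * θ / M * (1 - ρ) ^ q + M ^ θ * (1 - θ) * (1 - ρ) ^ q := by ring
    linarith
  · intro x hx
    have hc : 0 < ρ * x := mul_pos hρ0 hx.1
    have hH := add_mul_rpow_le_rpow_mul_rpow ha hc hv0 h0 h1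
    have b1 : 0 < 1 - ρ + ρ * x * v := by positivity
    have b2 : 0 < 1 - ρ + ρ * x := by positivity
    have hp : (1 - ρ + ρ * x * v ^ θ) ^ (q - 1) ≤
        ((1 - ρ + ρ * x * v) ^ (q - 1)) ^ θ * ((1 - ρ + ρ * x) ^ (q - 1)) ^ (1 - θ) := by
      have hcomm : ∀ {b : ℝ}, 0 ≤ b → ∀ s t : ℝ, (b ^ s) ^ t = (b ^ t) ^ s := fun hb s t => by
        rw [← Real.rpow_mul hb, mul_comm, Real.rpow_mul hb]
      rw [hcomm b1.le, hcomm b2.le, ← Real.mul_rpow (by positivity) (by positivity)]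
      exact Real.rpow_le_rpow (by positivity) hH (by linarith)
    have hY := hp.trans (young (Real.rpow_pos_of_pos b1 _) (Real.rpow_pos_of_pos b2 _))
    calc ρ * v ^ θ * q * (1 - ρ + ρ * v ^ θ * x) ^ (q - 1) / v ^ θ
        = ρ * q * (1 - ρ + ρ * x * v ^ θ) ^ (q - 1) := by
          rw [mul_right_comm ρ x]; field_simp
      _ ≤ ρ * q * (M ^ θ * (θ * ((1 - ρ + ρ * x * v) ^ (q - 1) / M) +
            (1 - θ) * (1 - ρ + ρ * x) ^ (q - 1))) := by gcongr
      _ = _ := by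
          rw [mul_right_comm ρ x]; field_simp

lemma Nfun_XalphaDist (q ρ α : ℝ) :
    Nfun (XalphaDist α) q ρ =
      1 / (1 + α) * (1 + ρ * α) ^ q + α / (1 + α) * (1 - ρ) ^ q := by
  have h : Nfun (XalphaDist α) q ρ =
      (XalphaDist α).sum fun t m => m * (1 + ρ * t) ^ q := rfl
  rw [h, XalphaDist, Finsupp.sum_add_index' (by simp) (by intros; ring),
    Finsupp.sum_single_index (by simp), Finsupp.sum_single_index (by simp)]
  ring_nf

lemma eq_XalphaDist_of_support {α : ℝ} (hα : 0 < α) {ν : ℝ →₀ ℝ}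
    (hνsum : ∑ t ∈ ν.support, ν t = 1) (hmean : ∑ t ∈ ν.support, ν t * t = 0)
    (hsupp : ∀ t ∈ ν.support, t = -1 ∨ t = α) : ν = XalphaDist α := by
  have hsub : ν.support ⊆ {-1, α} := fun t ht => by simpa using hsupp t ht
  have hne : (-1 : ℝ) ≠ α := by linarith
  rw [Finset.sum_subset hsub (by intro t _ ht; simpa using ht), Finset.sum_pair hne] at hνsum
  rw [Finset.sum_subset hsub (by intro t _ ht; simp [Finsupp.notMem_support_iff.1 ht]),
    Finset.sum_pair hne] at hmean
  have h1 : ν α = 1 / (1 + α) := by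
    rw [eq_div_iff (by positivity)]; linarith
  have h2 : ν (-1) = α / (1 + α) := by
    rw [eq_div_iff (by positivity)]
    have : ν (-1) = α * ν α := by linarith
    rw [this] at hνsum ⊢
    linear_combination α * hνsum
  ext t
  by_cases ht1 : t = -1
  · subst ht1; simp [XalphaDist, h2, hne.symm]
  by_cases ht2 : t = α
  · subst ht2; simp [XalphaDist, h1, hne]
  · have : ν t = 0 := by
      by_contra h
      exact (hsupp t (Finsupp.mem_support_iff.2 h)).elim ht1 ht2
    simp [XalphaDist, this, Ne.symm ht1, Ne.symm ht2]

lemma one_lt_sum_mul_one_add_rpow {q : ℝ} (hq : 1 < q) {ν : ℝ →₀ ℝ} (hνpos : ∀ t, 0 ≤ ν t)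
    (hνsum : ∑ t ∈ ν.support, ν t = 1) (hmean : ∑ t ∈ ν.support, ν t * t = 0)
    (hge : ∀ t ∈ ν.support, -1 ≤ t) (hne : ∃ t ∈ ν.support, t ≠ 0) :
    1 < ∑ t ∈ ν.support, ν t * (1 + t) ^ q := by
  have h1 : ∑ t ∈ ν.support, ν t * (1 + q * t) = 1 := by
    have : ∀ t ∈ ν.support, ν t * (1 + q * t) = ν t + q * (ν t * t) := fun t _ => by ring
    rw [Finset.sum_congr rfl this, Finset.sum_add_distrib, ← Finset.mul_sum, hνsum, hmean]
    simp
  obtain ⟨t₀, ht₀, hz⟩ := hne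
  refine h1.symm.trans_lt <| Finset.sum_lt_sum (fun t ht => mul_le_mul_of_nonneg_left
    (one_add_mul_self_le_rpow_one_add (hge t ht) hq.le) (hνpos t)) ⟨t₀, ht₀, ?_⟩
  exact mul_lt_mul_of_pos_left (one_add_mul_self_lt_rpow_one_add (hge t₀ ht₀) hz hq)
    ((hνpos t₀).lt_of_ne' (Finsupp.mem_support_iff.1 ht₀))

lemma sum_mul_one_add_rpow_lt {q α : ℝ} (hq : 1 < q) {ν : ℝ →₀ ℝ} (hνpos : ∀ t, 0 ≤ ν t)
    (hνsum : ∑ t ∈ ν.support, ν t = 1) (hmean : ∑ t ∈ ν.support, ν t * t = 0)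
    (hrange : ∀ t ∈ ν.support, -1 ≤ t ∧ t ≤ α)
    (hsupp : ∃ t ∈ ν.support, t ≠ -1 ∧ t ≠ α) :
    ∑ t ∈ ν.support, ν t * (1 + t) ^ q < (1 + α) ^ (q - 1) := by
  have hmul : ∀ t ∈ ν.support, (1 + t) ^ q = (1 + t) * (1 + t) ^ (q - 1) := fun t ht => by
    conv_rhs => rw [← Real.rpow_one_add' (by linarith [(hrange t ht).1]) (by linarith)]
    congr 1; ring
  have h1 : ∑ t ∈ ν.support, ν t * ((1 + t) * (1 + α) ^ (q - 1)) = (1 + α) ^ (q - 1) := by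
    have : ∀ t ∈ ν.support, ν t * ((1 + t) * (1 + α) ^ (q - 1)) =
      ν t * (1 + α) ^ (q - 1) + ν t * t * (1 + α) ^ (q - 1) := fun t _ => by ring
    rw [Finset.sum_congr rfl this, Finset.sum_add_distrib, ← Finset.sum_mul, ← Finset.sum_mul,
      hνsum, hmean]
    simp
  obtain ⟨t₀, ht₀, hm, ha⟩ := hsupp
  rw [← h1]
  refine Finset.sum_lt_sum (fun t ht => ?_) ⟨t₀, ht₀, ?_⟩
  · rw [hmul t ht]
    have h0 : 0 ≤ 1 + t := by linarith [(hrange t ht).1]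
    exact mul_le_mul_of_nonneg_left (mul_le_mul_of_nonneg_left
      (Real.rpow_le_rpow h0 (by linarith [(hrange t ht).2]) (by linarith)) h0) (hνpos t)
  · rw [hmul t₀ ht₀]
    have h0 : 0 < 1 + t₀ := by linarith [(hrange t₀ ht₀).1.lt_of_ne' hm]
    exact mul_lt_mul_of_pos_left (mul_lt_mul_of_pos_left
      (Real.rpow_lt_rpow h0.le (by linarith [(hrange t₀ ht₀).2.lt_of_ne ha]) (by linarith)) h0)
      ((hνpos t₀).lt_of_ne' (Finsupp.mem_support_iff.1 ht₀))

lemma Rfun_lt_of_ne_XalphaDist {q ρ α : ℝ} (hq : 2 ≤ q) (hρ0 : 0 < ρ) (hρ1 : ρ < 1)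
    (hα : 0 < α) {ν : ℝ →₀ ℝ} (hνpos : ∀ t, 0 ≤ ν t) (hνsum : ∑ t ∈ ν.support, ν t = 1)
    (hmean : ∑ t ∈ ν.support, ν t * t = 0) (hrange : ∀ t ∈ ν.support, -1 ≤ t ∧ t ≤ α)
    (hne : ∃ t ∈ ν.support, t ≠ 0) (hν : ν ≠ XalphaDist α) :
    Rfun ν q ρ < Rfun (XalphaDist α) q ρ := by
  have hp : 0 < q - 1 := by linarith
  have hβ : 0 < 1 + α := by linarith
  have hN1 : Nfun ν q 1 = ∑ t ∈ ν.support, ν t * (1 + t) ^ q := by simp [Nfun]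
  have hA1 : 1 < Nfun ν q 1 := hN1 ▸ one_lt_sum_mul_one_add_rpow (by linarith) hνpos hνsum hmean
    (fun t ht => (hrange t ht).1) hne
  have hA2 : Nfun ν q 1 < (1 + α) ^ (q - 1) := by
    rw [hN1]
    refine sum_mul_one_add_rpow_lt (by linarith) hνpos hνsum hmean hrange ?_
    by_contra! h
    exact hν (eq_XalphaDist_of_support hα hνsum hmean fun t ht => or_iff_not_imp_left.2 (h t ht))
  have hX1 : Nfun (XalphaDist α) q 1 = (1 + α) ^ (q - 1) := by
    rw [Nfun_XalphaDist, sub_self, Real.zero_rpow (by linarith), Real.rpow_sub_one hβ.ne']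
    ring_nf
  have hXρ : Nfun (XalphaDist α) q ρ = twoPointMoment q ρ (1 + α) := by
    rw [Nfun_XalphaDist, twoPointMoment_eq hβ]
    ring_nf
  set A := Nfun ν q 1
  have hA0 : 0 < A := by linarith
  have hlogA : 0 < Real.log A := Real.log_pos hA1
  have hlogβ : 0 < Real.log (1 + α) := Real.log_pos (by linarith)
  have hloglt : Real.log A < (q - 1) * Real.log (1 + α) := by
    rw [← Real.log_rpow hβ]; exact Real.log_lt_log hA0 hA2
  set θ := Real.log A / ((q - 1) * Real.log (1 + α)) with hθ
  have hθ0 : 0 < θ := by positivity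
  have hθ1 : θ < 1 := (div_lt_one (by positivity)).2 hloglt
  have hAθ : A = ((1 + α) ^ θ) ^ (q - 1) := by
    rw [← Real.rpow_mul hβ.le, Real.rpow_def_of_pos hβ, hθ]
    conv_lhs => rw [← Real.exp_log hA0]
    congr 1
    field_simp
  have hle : Nfun ν q ρ ≤ twoPointMoment q ρ ((1 + α) ^ θ) := by
    have h := sum_rpow_le_twoPointMoment (s := ν.support) (w := ν) (u := fun t => 1 + t)
      hq hρ0 hρ1 (Real.rpow_pos_of_pos hβ θ) (fun t _ => hνpos t)
      (fun t ht => by linarith [(hrange t ht).1]) hνsum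
      (by simp only [mul_add, mul_one, Finset.sum_add_distrib, hνsum, hmean, add_zero])
      (hN1.symm.trans hAθ)
    refine le_trans (le_of_eq ?_) h
    refine Finset.sum_congr rfl fun t _ => ?_
    ring_nf
  have hlt := hle.trans_lt (twoPointMoment_rpow_lt (by linarith) hρ0 hρ1 (by linarith) hθ0 hθ1)
  have hNpos : 0 < Nfun ν q ρ := by
    obtain ⟨t, ht, -⟩ := hne
    refine Finset.sum_pos (fun t ht => ?_) ⟨t, ht⟩
    have : 0 < 1 + ρ * t := by nlinarith [(hrange t ht).1]
    exact mul_pos ((hνpos t).lt_of_ne' (Finsupp.mem_support_iff.1 ht)) (by positivity)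
  have hM := one_lt_twoPointMoment (q := q) (by linarith) hρ0 hρ1 (v := 1 + α) (by linarith)
  have hlog := Real.log_lt_log hNpos hlt
  rw [Real.log_rpow (by linarith)] at hlog
  rw [Rfun, Rfun, hX1, hXρ, Real.log_rpow hβ, div_lt_iff₀ hlogA]
  refine hlog.trans_eq ?_
  rw [hθ]
  ring

theorem stmt8 (q ρ α : ℝ) (hq : 2 ≤ q) (hρ0 : 0 < ρ) (hρ1 : ρ < 1) (hα : 0 < α)
    (ν : ℝ →₀ ℝ) (hνpos : ∀ t, 0 ≤ ν t) (hνsum : ∑ t ∈ ν.support, ν t = 1)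
    (hmean : ∑ t ∈ ν.support, ν t * t = 0)
    (hrange : ∀ t ∈ ν.support, -1 ≤ t ∧ t ≤ α)
    (hne : ∃ t ∈ ν.support, t ≠ 0) :
    Rfun ν q ρ ≤ Rfun (XalphaDist α) q ρ ∧
      (Rfun ν q ρ = Rfun (XalphaDist α) q ρ ↔ ν = XalphaDist α) := by
  by_cases hν : ν = XalphaDist α
  · subst hν
    simp
  · have h := Rfun_lt_of_ne_XalphaDist hq hρ0 hρ1 hα hνpos hνsum hmean hrange hne hν
    exact ⟨h.le, iff_of_false h.ne hν⟩
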